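/- Under the assumptions of the momentum sketch-and-project convergence theorem with constant parameter η = 1/2 (so ζ_k = k/2), a finite sketch distribution with E[H_S] = Σ_i p_i H_{S_i} satisfying λ_min(E[H_S]) > 0, and any tolerance ε > 0: if t ≥ 4 ‖w^0 − w*‖²_W / (λ_min(E[H_S]) · ε), then E[‖A w^t − b‖²] ≤ ε. -/

import Mathlib

open Matrix

/-- `H_S = S (Sᵀ A W⁻¹ A S)⁻¹ Sᵀ`. -/
noncomputable def sketchH {m τ : ℕ} (A W : Matrix (Fin m) (Fin m) ℝ)
    (S : Matrix (Fin m) (Fin τ) ℝ) : Matrix (Fin m) (Fin m) ℝ :=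
  S * (Sᵀ * A * W⁻¹ * A * S)⁻¹ * Sᵀ

/-- `f_S(w) = ½ (A w − b)ᵀ H_S (A w − b)`. -/
noncomputable def sketchF {m τ : ℕ} (A W : Matrix (Fin m) (Fin m) ℝ)
    (S : Matrix (Fin m) (Fin τ) ℝ) (b w : Fin m → ℝ) : ℝ :=
  (1 / 2) * ((A *ᵥ w - b) ⬝ᵥ (sketchH A W S *ᵥ (A *ᵥ w - b)))

/-- `∇_W f_S(w) = W⁻¹ A H_S (A w − b)`. -/
noncomputable def sketchGrad {m τ : ℕ} (A W : Matrix (Fin m) (Fin m) ℝ)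
    (S : Matrix (Fin m) (Fin τ) ℝ) (b w : Fin m → ℝ) : Fin m → ℝ :=
  W⁻¹ *ᵥ (A *ᵥ (sketchH A W S *ᵥ (A *ᵥ w - b)))

/-- `uᵀ W u`, the squared `W`-norm. -/
def normSqW {m : ℕ} (W : Matrix (Fin m) (Fin m) ℝ) (u : Fin m → ℝ) : ℝ :=
  u ⬝ᵥ (W *ᵥ u)

/-- The momentum sketch-and-project iterates driven by a finite index sequence
`σ : Fin t → Fin q`.  `momIter … t σ = (z^{t-1}, w^t)`, starting from
`(z^{-1}, w⁰) = (w⁰, w⁰)`, with `z^t = z^{t-1} − η_t ∇_W f_{S_{σ_t}}(w^t)` and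
`w^{t+1} = (1 − 1/(ζ_{t+1}+1)) w^t + (1/(ζ_{t+1}+1)) z^t`. -/
noncomputable def momIter {m q : ℕ} (A W : Matrix (Fin m) (Fin m) ℝ) (b w0 : Fin m → ℝ)
    (τ : Fin q → ℕ) (S : (i : Fin q) → Matrix (Fin m) (Fin (τ i)) ℝ)
    (η ζ : ℕ → ℝ) : (t : ℕ) → (Fin t → Fin q) → ((Fin m → ℝ) × (Fin m → ℝ))
  | 0, _ => (w0, w0)
  | t + 1, σ =>
      let zw := momIter A W b w0 τ S η ζ t (fun k => σ k.castSucc)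
      let z' := zw.1 - η t • sketchGrad A W (S (σ (Fin.last t))) b zw.2
      (z', (1 - 1 / (ζ (t + 1) + 1)) • zw.2 + (1 / (ζ (t + 1) + 1)) • z')

lemma dot_symm_of_herm {n : ℕ} {M : Matrix (Fin n) (Fin n) ℝ} (hM : M.IsHermitian)
    (x y : Fin n → ℝ) : x ⬝ᵥ (M *ᵥ y) = y ⬝ᵥ (M *ᵥ x) := by
  have h : Mᵀ = M := by simpa [Matrix.IsHermitian] using hM
  conv_lhs => rw [dotProduct_mulVec, ← mulVec_transpose, h, dotProduct_comm]

lemma sketchH_posSemidef {m τ : ℕ} (A W : Matrix (Fin m) (Fin m) ℝ) (hA : A.PosDef)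
    (hW : W.PosDef) (S : Matrix (Fin m) (Fin τ) ℝ) : (sketchH A W S).PosSemidef := by
  have hAt : Aᴴ = A := hA.1
  have h1 : (Sᵀ * A * W⁻¹ * A * S).PosSemidef := by
    have := hW.inv.posSemidef.conjTranspose_mul_mul_same (A * S)
    rw [conjTranspose_mul, hAt] at this
    simpa [Matrix.mul_assoc] using this
  have := h1.inv.mul_mul_conjTranspose_same S
  simpa [sketchH] using this

lemma sketchH_proj {m τ : ℕ} (A W : Matrix (Fin m) (Fin m) ℝ)
    (S : Matrix (Fin m) (Fin τ) ℝ) (hS : IsUnit (Sᵀ * A * W⁻¹ * A * S)) :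
    sketchH A W S * (A * (W⁻¹ * (A * sketchH A W S))) = sketchH A W S := by
  have hd := (Matrix.isUnit_iff_isUnit_det _).1 hS
  have : sketchH A W S * (A * (W⁻¹ * (A * sketchH A W S))) =
      S * ((Sᵀ * A * W⁻¹ * A * S)⁻¹ * (Sᵀ * A * W⁻¹ * A * S)) *
        (Sᵀ * A * W⁻¹ * A * S)⁻¹ * Sᵀ := by
    simp only [sketchH, Matrix.mul_assoc]
  rw [this, Matrix.nonsing_inv_mul _ hd, Matrix.mul_one, sketchH]

lemma step_expand {m τ : ℕ} (A W : Matrix (Fin m) (Fin m) ℝ) (hA : A.PosDef)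
    (hW : W.PosDef) (S : Matrix (Fin m) (Fin τ) ℝ) (hS : IsUnit (Sᵀ * A * W⁻¹ * A * S))
    (b ws : Fin m → ℝ) (hws : A *ᵥ ws = b) (z w : Fin m → ℝ) :
    normSqW W (z - (1 / 2 : ℝ) • sketchGrad A W S b w - ws) =
      normSqW W (z - ws) - (A *ᵥ z - b) ⬝ᵥ (sketchH A W S *ᵥ (A *ᵥ w - b))
        + (1 / 4) * ((A *ᵥ w - b) ⬝ᵥ (sketchH A W S *ᵥ (A *ᵥ w - b))) := by
  have hH := (sketchH_posSemidef A W hA hW S).1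
  have hWd : IsUnit W.det := (Matrix.isUnit_iff_isUnit_det _).1 hW.isUnit
  set r := A *ᵥ w - b with hr
  set H := sketchH A W S with hHd
  set g := sketchGrad A W S b w with hg
  set u := z - ws with hu
  have hWg : W *ᵥ g = A *ᵥ (H *ᵥ r) := by
    rw [hg, sketchGrad, mulVec_mulVec, Matrix.mul_nonsing_inv _ hWd, one_mulVec]
  have hAu : A *ᵥ z - b = A *ᵥ u := by rw [hu, mulVec_sub, hws]
  have e1 : u ⬝ᵥ (W *ᵥ g) = (A *ᵥ u) ⬝ᵥ (H *ᵥ r) := by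
    rw [hWg, dot_symm_of_herm hA.1, dotProduct_comm]
  have e2 : g ⬝ᵥ (W *ᵥ u) = (A *ᵥ u) ⬝ᵥ (H *ᵥ r) := by
    rw [dot_symm_of_herm hW.1, e1]
  have e3 : g ⬝ᵥ (W *ᵥ g) = r ⬝ᵥ (H *ᵥ r) := by
    rw [hWg, dot_symm_of_herm hA.1, dotProduct_comm, dot_symm_of_herm hH, hg, sketchGrad]
    simp only [mulVec_mulVec]
    rw [← hHd, ← hr, sketchH_proj A W S hS]
  have e0 : z - (1 / 2 : ℝ) • g - ws = u - (1 / 2 : ℝ) • g := by rw [hu]; abel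
  rw [e0, hAu]
  simp only [normSqW, mulVec_sub, mulVec_smul, sub_dotProduct, dotProduct_sub,
    smul_dotProduct, dotProduct_smul, smul_eq_mul]
  rw [e1, e2, e3]
  ring

lemma key_quad {m : ℕ} (H : Matrix (Fin m) (Fin m) ℝ) (hH : H.PosSemidef)
    (a r r' : Fin m → ℝ) (ζ : ℝ) (hζ : 0 ≤ ζ) (h : a = (ζ + 1) • r' - ζ • r) :
    - (a ⬝ᵥ (H *ᵥ r')) + (1 / 4) * (r' ⬝ᵥ (H *ᵥ r'))
      + (ζ + 1 / 2) * ((1 / 2) * (r' ⬝ᵥ (H *ᵥ r'))) ≤ ζ * ((1 / 2) * (r ⬝ᵥ (H *ᵥ r))) := by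
  have h1 : 0 ≤ r' ⬝ᵥ (H *ᵥ r') := by simpa using hH.dotProduct_mulVec_nonneg r'
  have h2 : 0 ≤ (r - r') ⬝ᵥ (H *ᵥ (r - r')) := by
    simpa using hH.dotProduct_mulVec_nonneg (r - r')
  have h3 := dot_symm_of_herm hH.1 r' r
  subst h
  simp only [mulVec_sub, sub_dotProduct, dotProduct_sub,
    smul_dotProduct, smul_eq_mul] at h2 ⊢
  nlinarith [mul_nonneg hζ h2]

lemma lmin_bound {m : ℕ} (M : Matrix (Fin m) (Fin m) ℝ) (hM : M.IsHermitian)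
    (r : Fin m → ℝ) : (⨅ j, hM.eigenvalues j) * (r ⬝ᵥ r) ≤ r ⬝ᵥ (M *ᵥ r) := by
  set l := ⨅ j, hM.eigenvalues j with hl
  have hD : (diagonal (fun j => hM.eigenvalues j - l)).PosSemidef := by
    rw [posSemidef_diagonal_iff]
    intro j
    exact sub_nonneg.2 (ciInf_le (Set.finite_range _).bddBelow j)
  have h1 := hD.mul_mul_conjTranspose_same (hM.eigenvectorUnitary : Matrix (Fin m) (Fin m) ℝ)
  have h2 : (hM.eigenvectorUnitary : Matrix (Fin m) (Fin m) ℝ) *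
      diagonal (fun j => hM.eigenvalues j - l) *
      (hM.eigenvectorUnitary : Matrix (Fin m) (Fin m) ℝ)ᴴ = M - l • 1 := by
    have hs := hM.spectral_theorem
    rw [Unitary.conjStarAlgAut_apply] at hs
    have hd : diagonal (fun j => hM.eigenvalues j - l) =
        diagonal (RCLike.ofReal ∘ hM.eigenvalues) - l • (1 : Matrix (Fin m) (Fin m) ℝ) := by
      ext i j
      by_cases hij : i = j
      · subst hij; simp
      · simp [hij]
    have hu : (hM.eigenvectorUnitary : Matrix (Fin m) (Fin m) ℝ) *
      (hM.eigenvectorUnitary : Matrix (Fin m) (Fin m) ℝ)ᴴ = 1 :=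
      Unitary.mul_star_self_of_mem hM.eigenvectorUnitary.2
    rw [hd, Matrix.mul_sub, Matrix.sub_mul, Matrix.mul_smul, Matrix.mul_one, Matrix.smul_mul, hu]
    congr 1
    exact hs.symm
  rw [h2] at h1
  have h3 := h1.dotProduct_mulVec_nonneg r
  simp only [star_trivial, sub_mulVec, smul_mulVec, one_mulVec, dotProduct_sub,
    dotProduct_smul, smul_eq_mul] at h3
  linarith

lemma sum_snoc_expect {q t : ℕ} (p : Fin q → ℝ) (G : (Fin t → Fin q) → Fin q → ℝ) :
    ∑ σ : Fin (t + 1) → Fin q, (∏ k, p (σ k)) * G (fun k => σ k.castSucc) (σ (Fin.last t)) =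
      ∑ σ : Fin t → Fin q, (∏ k, p (σ k)) * ∑ i, p i * G σ i := by
  rw [← (Fin.snocEquiv (fun _ : Fin (t + 1) => Fin q)).sum_comp, Fintype.sum_prod_type,
    Finset.sum_comm]
  refine Finset.sum_congr rfl fun σ _ => ?_
  rw [Finset.mul_sum]
  refine Finset.sum_congr rfl fun i _ => ?_
  simp [Fin.snocEquiv, Fin.prod_univ_castSucc, mul_assoc]

lemma dot_sum_mulVec {m q : ℕ} (p : Fin q → ℝ) (H : Fin q → Matrix (Fin m) (Fin m) ℝ)
    (x y : Fin m → ℝ) :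
    x ⬝ᵥ ((∑ i, p i • H i) *ᵥ y) = ∑ i, p i * (x ⬝ᵥ (H i *ᵥ y)) := by
  rw [sum_mulVec, dotProduct_sum]
  simp [smul_mulVec]

/-- Lyapunov function. -/
noncomputable def lyapQ {m q : ℕ} (A W : Matrix (Fin m) (Fin m) ℝ) (b ws : Fin m → ℝ)
    (τ : Fin q → ℕ) (S : (i : Fin q) → Matrix (Fin m) (Fin (τ i)) ℝ) (p : Fin q → ℝ)
    (t : ℕ) (z w : Fin m → ℝ) : ℝ :=
  ∑ i, p i * (normSqW W (z - (1 / 2 : ℝ) • sketchGrad A W (S i) b w - ws)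
    + ((t : ℝ) + 1) / 2 * sketchF A W (S i) b w)

lemma lyap_step {m q : ℕ} (A W : Matrix (Fin m) (Fin m) ℝ) (hA : A.PosDef) (hW : W.PosDef)
    (b ws : Fin m → ℝ) (hws : A *ᵥ ws = b)
    (τ : Fin q → ℕ) (S : (i : Fin q) → Matrix (Fin m) (Fin (τ i)) ℝ)
    (hS : ∀ i, IsUnit ((S i)ᵀ * A * W⁻¹ * A * S i))
    (p : Fin q → ℝ) (hp : ∀ i, 0 ≤ p i) (hp1 : ∑ i, p i = 1) (t : ℕ) (z w w' : Fin m → ℝ)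
    (ζ : ℝ) (hζ : ζ = ((t : ℝ) + 1) / 2)
    (hw' : w' = (1 - 1 / (ζ + 1)) • w + (1 / (ζ + 1)) • z) :
    lyapQ A W b ws τ S p (t + 1) z w' ≤
      normSqW W (z - ws) + ζ * ∑ i, p i * sketchF A W (S i) b w := by
  have h0 : normSqW W (z - ws) = ∑ i, p i * normSqW W (z - ws) := by
    rw [← Finset.sum_mul, hp1, one_mul]
  have hζ0 : 0 ≤ ζ := by rw [hζ]; positivity
  rw [h0, Finset.mul_sum, ← Finset.sum_add_distrib, lyapQ]
  refine Finset.sum_le_sum fun i _ => ?_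
  have ha : A *ᵥ z - b = (ζ + 1) • (A *ᵥ w' - b) - ζ • (A *ᵥ w - b) := by
    have : (ζ + 1) ≠ 0 := by positivity
    rw [hw', mulVec_add, mulVec_smul, mulVec_smul]
    ext j
    simp only [Pi.sub_apply, Pi.smul_apply, Pi.add_apply, smul_eq_mul]
    field_simp
    ring
  have hk := key_quad _ (sketchH_posSemidef A W hA hW (S i)) _ _ _ ζ hζ0 ha
  rw [step_expand A W hA hW (S i) (hS i) b ws hws]
  have hc : (((t + 1 : ℕ) : ℝ) + 1) / 2 = ζ + 1 / 2 := by rw [hζ]; push_cast; ring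
  rw [hc]
  simp only [sketchF]
  nlinarith [mul_le_mul_of_nonneg_left hk (hp i)]

/-- **Iteration complexity of momentum sketch-and-project with `η = 1/2`
(Corollary 1, complexity form):** with `ζ_k = k/2` and `λ_min(E[H_S]) > 0`, if
`t ≥ 4 ‖w⁰ − w*‖²_W / (λ_min(E[H_S]) ε)` then `E[‖A wᵗ − b‖²] ≤ ε`.
(The hypothesis `hEH` records the — always valid — fact that `E[H_S]` is symmetric.) -/
theorem momentum_iteration_complexity {m q : ℕ}
    (A W : Matrix (Fin m) (Fin m) ℝ) (hA : A.PosDef) (hW : W.PosDef)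
    (b wstar : Fin m → ℝ) (hwstar : wstar = A⁻¹ *ᵥ b)
    (τ : Fin q → ℕ) (S : (i : Fin q) → Matrix (Fin m) (Fin (τ i)) ℝ)
    (hS : ∀ i, IsUnit ((S i)ᵀ * A * W⁻¹ * A * S i))
    (p : Fin q → ℝ) (hp : ∀ i, 0 ≤ p i) (hp1 : ∑ i, p i = 1)
    (hEH : (∑ i, p i • sketchH A W (S i)).IsHermitian)
    (hlmin : 0 < ⨅ j, hEH.eigenvalues j)
    (w0 : Fin m → ℝ) (ε : ℝ) (hε : 0 < ε) (t : ℕ)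
    (ht : 4 * normSqW W (w0 - wstar) / ((⨅ j, hEH.eigenvalues j) * ε) ≤ (t : ℝ)) :
    ∑ σ : Fin t → Fin q, (∏ k, p (σ k)) *
        ((A *ᵥ (momIter A W b w0 τ S (fun _ => 1 / 2) (fun k => (k : ℝ) / 2) t σ).2 - b) ⬝ᵥ
          (A *ᵥ (momIter A W b w0 τ S (fun _ => 1 / 2) (fun k => (k : ℝ) / 2) t σ).2 - b))
      ≤ ε := by
  have hws : A *ᵥ wstar = b := by
    rw [hwstar, mulVec_mulVec,
      Matrix.mul_nonsing_inv _ ((Matrix.isUnit_iff_isUnit_det _).1 hA.isUnit), one_mulVec]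
  set l := ⨅ j, hEH.eigenvalues j with hl
  set N := normSqW W (w0 - wstar) with hN
  have hF0 : ∀ i w, 0 ≤ sketchF A W (S i) b w := by
    intro i w
    have := (sketchH_posSemidef A W hA hW (S i)).dotProduct_mulVec_nonneg (A *ᵥ w - b)
    simp only [star_trivial] at this
    unfold sketchF
    positivity
  have hind : ∀ t : ℕ, ∑ σ : Fin t → Fin q, (∏ k, p (σ k)) *
      lyapQ A W b wstar τ S p t
        (momIter A W b w0 τ S (fun _ => 1 / 2) (fun k => (k : ℝ) / 2) t σ).1
        (momIter A W b w0 τ S (fun _ => 1 / 2) (fun k => (k : ℝ) / 2) t σ).2 ≤ N := by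
    intro t
    induction t with
    | zero =>
      simp only [momIter, Finset.univ_unique, Finset.sum_singleton, Finset.univ_eq_empty,
        Finset.prod_empty, one_mul]
      have h0 : N = ∑ i, p i * N := by rw [← Finset.sum_mul, hp1, one_mul]
      rw [h0, lyapQ]
      refine Finset.sum_le_sum fun i _ => mul_le_mul_of_nonneg_left ?_ (hp i)
      rw [step_expand A W hA hW (S i) (hS i) b wstar hws]
      have := hF0 i w0
      simp only [sketchF] at this ⊢
      push_cast
      linarith
    | succ t ih =>
      refine le_trans ?_ ih
      have e := sum_snoc_expect p (t := t) (fun σ i =>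
        lyapQ A W b wstar τ S p (t + 1)
          ((momIter A W b w0 τ S (fun _ => 1 / 2) (fun k => (k : ℝ) / 2) t σ).1 -
            (1 / 2 : ℝ) • sketchGrad A W (S i) b
              (momIter A W b w0 τ S (fun _ => 1 / 2) (fun k => (k : ℝ) / 2) t σ).2)
          ((1 - 1 / (((t + 1 : ℕ) : ℝ) / 2 + 1)) •
            (momIter A W b w0 τ S (fun _ => 1 / 2) (fun k => (k : ℝ) / 2) t σ).2 +
            (1 / (((t + 1 : ℕ) : ℝ) / 2 + 1)) •
          ((momIter A W b w0 τ S (fun _ => 1 / 2) (fun k => (k : ℝ) / 2) t σ).1 -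
            (1 / 2 : ℝ) • sketchGrad A W (S i) b
              (momIter A W b w0 τ S (fun _ => 1 / 2) (fun k => (k : ℝ) / 2) t σ).2)))
      refine (le_of_eq e).trans ?_
      refine Finset.sum_le_sum fun σ _ => mul_le_mul_of_nonneg_left ?_
        (Finset.prod_nonneg fun k _ => hp _)
      generalize momIter A W b w0 τ S (fun _ => 1 / 2) (fun k => (k : ℝ) / 2) t σ = zw
      obtain ⟨z, w⟩ := zw
      refine (Finset.sum_le_sum fun i _ => mul_le_mul_of_nonneg_left
        (lyap_step A W hA hW b wstar hws τ S hS p hp hp1 t _ w _ (((t + 1 : ℕ) : ℝ) / 2)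
          (by push_cast; ring) rfl) (hp i)).trans (le_of_eq ?_)
      simp only [mul_add, Finset.sum_add_distrib, lyapQ, ← Finset.sum_mul, hp1, one_mul]
      congr 1
      rw [Finset.mul_sum]
      refine Finset.sum_congr rfl fun i _ => ?_
      push_cast
      ring
  have hlow : ∀ z w, ((t : ℝ) + 1) / 4 * l * ((A *ᵥ w - b) ⬝ᵥ (A *ᵥ w - b)) ≤
      lyapQ A W b wstar τ S p t z w := by
    intro z w
    have h1 := lmin_bound _ hEH (A *ᵥ w - b)
    rw [dot_sum_mulVec] at h1
    have h2 : ((t : ℝ) + 1) / 4 * ∑ i, p i * ((A *ᵥ w - b) ⬝ᵥ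
        (sketchH A W (S i) *ᵥ (A *ᵥ w - b))) ≤ lyapQ A W b wstar τ S p t z w := by
      rw [lyapQ, Finset.mul_sum]
      refine Finset.sum_le_sum fun i _ => ?_
      have h3 : 0 ≤ normSqW W (z - (1 / 2 : ℝ) • sketchGrad A W (S i) b w - wstar) := by
        simpa [normSqW] using hW.posSemidef.dotProduct_mulVec_nonneg
          (z - (1 / 2 : ℝ) • sketchGrad A W (S i) b w - wstar)
      have h4 := mul_nonneg (hp i) h3
      rw [mul_add, sketchF]
      linarith
    refine le_trans ?_ h2
    rw [mul_assoc]
    exact mul_le_mul_of_nonneg_left h1 (by positivity)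
  have hfin : ((t : ℝ) + 1) / 4 * l * (∑ σ : Fin t → Fin q, (∏ k, p (σ k)) *
        ((A *ᵥ (momIter A W b w0 τ S (fun _ => 1 / 2) (fun k => (k : ℝ) / 2) t σ).2 - b) ⬝ᵥ
          (A *ᵥ (momIter A W b w0 τ S (fun _ => 1 / 2) (fun k => (k : ℝ) / 2) t σ).2 - b)))
      ≤ N := by
    refine le_trans ?_ (hind t)
    rw [Finset.mul_sum]
    refine Finset.sum_le_sum fun σ _ => ?_
    rw [mul_left_comm]
    exact mul_le_mul_of_nonneg_left (hlow _ _) (Finset.prod_nonneg fun k _ => hp _)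
  rw [div_le_iff₀ (by positivity)] at ht
  have hc : 0 < ((t : ℝ) + 1) / 4 * l := by positivity
  refine le_of_mul_le_mul_left (hfin.trans ?_) hc
  have : 0 < l * ε := by positivity
  linarith
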